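/- Let 1 ≤ k ≤ n, let H₀ be a Hermitian operator on (ℂ^d)^{⊗k}, and let H = H₀ ⊗ I act on (ℂ^d)^{⊗n} (acting nontrivially only on the first k qudits). Then for every linear operator O on (ℂ^d)^{⊗n} with ‖O‖₂ = 1, the influence rate satisfies |R_I(H,O)| ≤ 4·k·‖H‖∞. -/

import Mathlib

open Matrix Complex BigOperators
open scoped ComplexOrder
noncomputable section

namespace QC

/-- Operators on the `n`-qudit space `(ℂ^d)^{⊗n}`, as matrices indexed by
computational basis labels `Fin n → Fin d`. -/
abbrev QOp (d n : ℕ) := Matrix (Fin n → Fin d) (Fin n → Fin d) ℂ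

/-- The qudit shift operator `X`, with `X|j⟩ = |j+1 mod d⟩`. -/
def shiftX (d : ℕ) : Matrix (Fin d) (Fin d) ℂ :=
  fun i j => if (i : ℕ) = ((j : ℕ) + 1) % d then 1 else 0

/-- The qudit clock operator `Z`, with `Z|j⟩ = e^{2πij/d}|j⟩`. -/
def clockZ (d : ℕ) : Matrix (Fin d) (Fin d) ℂ :=
  Matrix.diagonal (fun j => Complex.exp (2 * Real.pi * Complex.I * (j : ℕ) / d))

/-- The single-qudit Pauli operator `P_a = X^s Z^t` for `a = (s,t) ∈ ℤ_d × ℤ_d`. -/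
def pauli1 (d : ℕ) (a : ZMod d × ZMod d) : Matrix (Fin d) (Fin d) ℂ :=
  shiftX d ^ a.1.val * clockZ d ^ a.2.val

/-- The `n`-qudit Pauli operator `P_ā = P_{a_1} ⊗ ⋯ ⊗ P_{a_n}`. -/
def pauliN (d n : ℕ) (a : Fin n → ZMod d × ZMod d) : QOp d n :=
  fun x y => ∏ i, pauli1 d (a i) (x i) (y i)

/-- The weight `|ā|`: the number of indices `i` with `a_i ≠ (0,0)`. -/
def weight (d n : ℕ) (a : Fin n → ZMod d × ZMod d) : ℕ :=
  (Finset.univ.filter (fun i => a i ≠ 0)).card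

/-- `P_O[ā] = |Tr(O P_ā)|² / d^{2n}`. -/
def pdist (d n : ℕ) (O : QOp d n) (a : Fin n → ZMod d × ZMod d) : ℝ :=
  ‖(O * pauliN d n a).trace‖ ^ 2 / (d : ℝ) ^ (2 * n)

/-- The normalized 2-norm `‖O‖₂ = (Tr(O†O)/d^n)^{1/2}`. -/
def l2norm (d n : ℕ) (O : QOp d n) : ℝ :=
  Real.sqrt (((Oᴴ * O).trace).re / (d : ℝ) ^ n)

/-- The total influence `I[O] = Σ_ā |ā|·P_O[ā]`. -/
def influence (d n : ℕ) [NeZero d] (O : QOp d n) : ℝ :=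
  ∑ a : Fin n → ZMod d × ZMod d, (weight d n a : ℝ) * pdist d n O a

/-- The local influence `I_j[O] = Σ_{ā : a_j ≠ 0} P_O[ā]`. -/
def localInfluence (d n : ℕ) [NeZero d] (j : Fin n) (O : QOp d n) : ℝ :=
  ∑ a ∈ Finset.univ.filter (fun a : Fin n → ZMod d × ZMod d => a j ≠ 0), pdist d n O a

/-- The quantum Fourier entropy `H[O] = -Σ_ā P_O[ā] log₂ P_O[ā]` (with `0·log 0 = 0`). -/
def qEntropy (d n : ℕ) [NeZero d] (O : QOp d n) : ℝ :=
  -∑ a : Fin n → ZMod d × ZMod d, pdist d n O a * Real.logb 2 (pdist d n O a)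

/-- The binary entropy `h(x) = -x log₂ x - (1-x) log₂ (1-x)`. -/
def binEntropy (x : ℝ) : ℝ :=
  -(x * Real.logb 2 x) - (1 - x) * Real.logb 2 (1 - x)

/-- Circuit sensitivity `CiS[U] = sup { |I[UOU†] - I[O]| : ‖O‖₂ = 1 }`. -/
def CiS (d n : ℕ) [NeZero d] (U : QOp d n) : ℝ :=
  sSup {x : ℝ | ∃ O : QOp d n, l2norm d n O = 1 ∧
    x = |influence d n (U * O * Uᴴ) - influence d n O|}

/-- Magic power `𝓜[U] = sup { |H[UOU†] - H[O]| : ‖O‖₂ = 1 }`. -/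
def magicPower (d n : ℕ) [NeZero d] (U : QOp d n) : ℝ :=
  sSup {x : ℝ | ∃ O : QOp d n, l2norm d n O = 1 ∧
    x = |qEntropy d n (U * O * Uᴴ) - qEntropy d n O|}

/-- Magic entropy `M[U] = max { H[U P_ā U†] : |ā| = 1 }`. -/
def magicEntropy (d n : ℕ) [NeZero d] (U : QOp d n) : ℝ :=
  sSup {x : ℝ | ∃ a : Fin n → ZMod d × ZMod d, weight d n a = 1 ∧
    x = qEntropy d n (U * pauliN d n a * Uᴴ)}

/-- The operator norm `‖A‖∞` (the L2 → L2 operator norm). -/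
def opNorm (d n : ℕ) (A : QOp d n) : ℝ :=
  ‖Matrix.toEuclideanCLM (𝕜 := ℂ) (n := Fin n → Fin d) A‖

/-- The influence rate `R_I(H,O)`. -/
def influenceRate (d n : ℕ) [NeZero d] (H O : QOp d n) : ℂ :=
  (Complex.I / (d : ℂ) ^ (2 * n)) * ∑ a : Fin n → ZMod d × ZMod d, (weight d n a : ℂ) *
    (((O * H - H * O) * pauliN d n a).trace * (O * (pauliN d n a)ᴴ).trace +
     ((O * H - H * O) * (pauliN d n a)ᴴ).trace * (O * pauliN d n a).trace)

/-- The magic rate `R_M(H,O)`. -/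
def magicRate (d n : ℕ) [NeZero d] (H O : QOp d n) : ℂ :=
  (Complex.I / (d : ℂ) ^ (2 * n)) * ∑ a : Fin n → ZMod d × ZMod d,
    (((O * H - H * O) * pauliN d n a).trace * (O * (pauliN d n a)ᴴ).trace +
     ((O * H - H * O) * (pauliN d n a)ᴴ).trace * (O * pauliN d n a).trace) *
    (Real.logb 2 (pdist d n O a) : ℂ)

/-- Extend an operator on the first `k` qudits by the identity: `H₀ ⊗ I`. -/
def extendOp (d k n : ℕ) (h : k ≤ n) (H0 : QOp d k) : QOp d n :=
  fun x y => if ∀ i : Fin n, k ≤ (i : ℕ) → x i = y i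
    then H0 (fun i => x (Fin.castLE h i)) (fun i => y (Fin.castLE h i)) else 0

/-- The tensor product `A ⊗ B` of an `n₁`-qudit and an `n₂`-qudit operator. -/
def tensorOp (d n₁ n₂ : ℕ) (A : QOp d n₁) (B : QOp d n₂) : QOp d (n₁ + n₂) :=
  fun x y => A (fun i => x (Fin.castAdd n₂ i)) (fun i => y (Fin.castAdd n₂ i)) *
             B (fun i => x (Fin.natAdd n₁ i)) (fun i => y (Fin.natAdd n₁ i))

/-- Embed a single-qudit operator `W` at position `j` (identity elsewhere). -/
def embedAt (d n : ℕ) (j : Fin n) (W : Matrix (Fin d) (Fin d) ℂ) : QOp d n :=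
  fun x y => if ∀ i, i ≠ j → x i = y i then W (x j) (y j) else 0

/-- The swap unitary exchanging qudits `i` and `j`. -/
def swapOp (d n : ℕ) (i j : Fin n) : QOp d n :=
  fun x y => if x = y ∘ Equiv.swap i j then 1 else 0

/-- The qubit Pauli X matrix. -/
def pauliX : Matrix (Fin 2) (Fin 2) ℂ := !![0, 1; 1, 0]

/-- The qubit Pauli Y matrix. -/
def pauliY : Matrix (Fin 2) (Fin 2) ℂ := !![0, -Complex.I; Complex.I, 0]

/-- The qubit Pauli Z matrix. -/
def pauliZ : Matrix (Fin 2) (Fin 2) ℂ := !![1, 0; 0, -1]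

/-- The ordered product `γ^S = ∏_{i∈S} γ_i` (factors in increasing index order). -/
def gammaProd (n : ℕ) (γ : Fin (2 * n) → QOp 2 n) (S : Finset (Fin (2 * n))) : QOp 2 n :=
  ((S.sort (· ≤ ·)).map γ).prod

/-- `P^G_O[S] = |Tr((γ^S)† O)|² / 2^{2n}`. -/
def pdistG (n : ℕ) (γ : Fin (2 * n) → QOp 2 n) (O : QOp 2 n) (S : Finset (Fin (2 * n))) : ℝ :=
  ‖((gammaProd n γ S)ᴴ * O).trace‖ ^ 2 / (2 : ℝ) ^ (2 * n)

/-- The Gaussian influence `I^G[O] = Σ_S |S|·P^G_O[S]`. -/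
def influenceG (n : ℕ) (γ : Fin (2 * n) → QOp 2 n) (O : QOp 2 n) : ℝ :=
  ∑ S : Finset (Fin (2 * n)), (S.card : ℝ) * pdistG n γ O S

/-- The Gaussian Fourier entropy `H^G[O] = -Σ_S P^G_O[S] log₂ P^G_O[S]`. -/
def entropyG (n : ℕ) (γ : Fin (2 * n) → QOp 2 n) (O : QOp 2 n) : ℝ :=
  -∑ S : Finset (Fin (2 * n)), pdistG n γ O S * Real.logb 2 (pdistG n γ O S)

/-- Gaussian circuit sensitivity `CiS^G[U] = sup { |I^G[UOU†] - I^G[O]| : ‖O‖₂ = 1 }`. -/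
def CiSG (n : ℕ) (γ : Fin (2 * n) → QOp 2 n) (U : QOp 2 n) : ℝ :=
  sSup {x : ℝ | ∃ O : QOp 2 n, l2norm 2 n O = 1 ∧
    x = |influenceG n γ (U * O * Uᴴ) - influenceG n γ O|}

/-- Fourier coefficient `f̂(S)` of a Boolean function `f : {-1,1}^n → ℝ`, with
the domain encoded as `Fin n → Bool` (`true ↦ -1`, `false ↦ 1`). -/
def fourierCoeff (n : ℕ) (f : (Fin n → Bool) → ℝ) (S : Finset (Fin n)) : ℝ :=
  (∑ x : Fin n → Bool, f x * ∏ i ∈ S, (if x i then -1 else 1)) / 2 ^ n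

/-- Fourier entropy of a Boolean function. -/
def boolEntropy (n : ℕ) (f : (Fin n → Bool) → ℝ) : ℝ :=
  -∑ S : Finset (Fin n), (fourierCoeff n f S) ^ 2 * Real.logb 2 ((fourierCoeff n f S) ^ 2)

/-- Total influence of a Boolean function. -/
def boolInfluence (n : ℕ) (f : (Fin n → Bool) → ℝ) : ℝ :=
  ∑ S : Finset (Fin n), (S.card : ℝ) * (fourierCoeff n f S) ^ 2

/-- The completely dephasing channel `Δ`. -/
def dephase (d n : ℕ) (A : QOp d n) : QOp d n :=
  Matrix.diagonal (fun i => A i i)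

/-- The diagonal matrix `log₂ Δ(ρ)` (entrywise base-2 logarithm of the diagonal). -/
def logDephase (d n : ℕ) (A : QOp d n) : QOp d n :=
  Matrix.diagonal (fun i => (Real.logb 2 (A i i).re : ℂ))

/-- The coherence rate `R_C(H,ρ) = -i Tr([ρ, log Δ(ρ)] H)`. -/
def cohRate (d n : ℕ) (H ρ : QOp d n) : ℂ :=
  -Complex.I * ((ρ * logDephase d n ρ - logDephase d n ρ * ρ) * H).trace

/-- The max-relative entropy `D_max(ρ‖σ) = log₂ min{λ > 0 : ρ ≤ λσ}`. -/
def Dmax (d n : ℕ) (ρ σ : QOp d n) : ℝ :=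
  Real.logb 2 (sInf {l : ℝ | 0 < l ∧ ((l : ℂ) • σ - ρ).PosSemidef})

variable {d n : ℕ}

lemma shiftX_pow_apply [NeZero d] (s : ℕ) (x y : Fin d) :
    (shiftX d ^ s) x y = if (x : ℕ) = ((y : ℕ) + s) % d then 1 else 0 := by
  induction s generalizing y with
  | zero =>
    simp [Matrix.one_apply, Nat.mod_eq_of_lt y.isLt, Fin.ext_iff]
  | succ s ih =>
    rw [pow_succ, Matrix.mul_apply,
      Finset.sum_eq_single (⟨((y : ℕ) + 1) % d, Nat.mod_lt _ (NeZero.pos d)⟩ : Fin d)]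
    · simp [ih, shiftX, add_assoc, add_comm 1 s]
    · intro u _ hu
      have : ¬ (u : ℕ) = ((y : ℕ) + 1) % d := fun h => hu (Fin.ext h)
      simp [shiftX, this]
    · simp

lemma pauli1_apply [NeZero d] (a : ZMod d × ZMod d) (x y : Fin d) :
    pauli1 d a x y = (if (x : ℕ) = ((y : ℕ) + a.1.val) % d then 1 else 0) *
      (Complex.exp (2 * Real.pi * Complex.I / d) ^ (y : ℕ)) ^ a.2.val := by
  rw [pauli1, clockZ, Matrix.diagonal_pow, Matrix.mul_diagonal, shiftX_pow_apply, Pi.pow_apply,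
    ← Complex.exp_nat_mul _ (y : ℕ)]
  congr 3
  ring

lemma sum_zmod_val [NeZero d] (f : ℕ → ℂ) :
    ∑ t : ZMod d, f t.val = ∑ t ∈ Finset.range d, f t := by
  refine Finset.sum_bij (fun t _ => t.val) (fun t _ => Finset.mem_range.2 t.val_lt)
    (fun _ _ _ _ h => ZMod.val_injective d h)
    (fun t ht => ⟨(t : ZMod d), Finset.mem_univ _, ZMod.val_cast_of_lt (Finset.mem_range.1 ht)⟩)
    (fun _ _ => rfl)

lemma sum_character_mul_star [NeZero d] (y w : Fin d) :
    ∑ t : ZMod d, (Complex.exp (2 * Real.pi * Complex.I / d) ^ (y : ℕ)) ^ t.val *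
      star ((Complex.exp (2 * Real.pi * Complex.I / d) ^ (w : ℕ)) ^ t.val) =
      if y = w then (d : ℂ) else 0 := by
  set ω := Complex.exp (2 * Real.pi * Complex.I / d) with hω
  have hprim : IsPrimitiveRoot ω d := Complex.isPrimitiveRoot_exp d (NeZero.ne d)
  have hstar : star ω = ω⁻¹ := by
    rw [hω, ← Complex.exp_neg, Complex.star_def, ← Complex.exp_conj]
    congr 1
    simp [neg_div, Complex.conj_ofNat]
  have h0 : ω ≠ 0 := Complex.exp_ne_zero _
  have hterm (t : ℕ) : (ω ^ (y : ℕ)) ^ t * star ((ω ^ (w : ℕ)) ^ t) =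
      (ω ^ (y : ℕ) * (ω ^ (w : ℕ))⁻¹) ^ t := by
    rw [star_pow, star_pow, hstar, mul_pow, inv_pow, inv_pow]
  simp_rw [hterm]
  rw [sum_zmod_val fun t => (ω ^ (y : ℕ) * (ω ^ (w : ℕ))⁻¹) ^ t]
  split_ifs with h
  · subst h
    simp [h0]
  · have hne : ω ^ (y : ℕ) * (ω ^ (w : ℕ))⁻¹ ≠ 1 := by
      intro h1
      rw [mul_inv_eq_one₀ (pow_ne_zero _ h0)] at h1
      exact h (Fin.ext (hprim.pow_inj y.isLt w.isLt h1))
    have := geom_sum_eq hne d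
    rw [this, mul_pow, inv_pow, ← pow_mul, ← pow_mul, mul_comm _ d, mul_comm _ d, pow_mul,
      pow_mul, hprim.pow_eq_one]
    simp

/-- Completeness of the single-qudit Pauli operators. -/
lemma sum_pauli1_mul_star [NeZero d] (x y z w : Fin d) :
    ∑ a : ZMod d × ZMod d, pauli1 d a x y * star (pauli1 d a z w) =
      if x = z ∧ y = w then (d : ℂ) else 0 := by
  have hrow (s : ZMod d) :
      ∑ t : ZMod d, pauli1 d (s, t) x y * star (pauli1 d (s, t) z w) =
        (if (x : ℕ) = ((y : ℕ) + s.val) % d then 1 else 0) *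
          star (if (z : ℕ) = ((w : ℕ) + s.val) % d then (1 : ℂ) else 0) *
          if y = w then (d : ℂ) else 0 := by
    rw [← sum_character_mul_star, Finset.mul_sum]
    refine Finset.sum_congr rfl fun t _ => ?_
    rw [pauli1_apply, pauli1_apply, star_mul']
    ring
  simp_rw [Fintype.sum_prod_type, hrow]
  by_cases hyw : y = w
  · subst hyw
    simp only [if_true, and_true, ← Finset.sum_mul]
    rw [sum_zmod_val fun s => (if (x : ℕ) = ((y : ℕ) + s) % d then (1 : ℂ) else 0) *
      star (if (z : ℕ) = ((y : ℕ) + s) % d then (1 : ℂ) else 0)]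
    have hs : ((y : ℕ) + ((x : ℕ) + (d - y)) % d) % d = x := by
      rw [Nat.add_mod_mod, show (y : ℕ) + (x + (d - y)) = x + d by omega, Nat.add_mod_right,
        Nat.mod_eq_of_lt x.isLt]
    rw [Finset.sum_eq_single (((x : ℕ) + (d - y)) % d)]
    · rw [hs]
      by_cases hxz : x = z
      · simp [hxz]
      · simp [hxz, Fin.ext_iff.not.1 (Ne.symm hxz)]
    · intro s hs' hne
      have : ¬ (x : ℕ) = ((y : ℕ) + s) % d := by
        intro h
        apply hne
        rw [h, Nat.mod_add_mod, show (y : ℕ) + s + (d - y) = s + d by omega, Nat.add_mod_right,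
          Nat.mod_eq_of_lt (Finset.mem_range.1 hs')]
      simp [this]
    · intro h
      exact absurd (Finset.mem_range.2 (Nat.mod_lt _ (NeZero.pos d))) h
  · simp [hyw]

lemma pauli1_zero [NeZero d] : pauli1 d 0 = 1 := by
  simp [pauli1]

/-- Pauli sums with a product weight factorize over the sites. -/
lemma sum_prod_mul_trace_mul_trace [NeZero d] (g : Fin n → ZMod d × ZMod d → ℂ) (A B : QOp d n) :
    ∑ a : Fin n → ZMod d × ZMod d, (∏ i, g i (a i)) *
      ((A * pauliN d n a).trace * (B * (pauliN d n a)ᴴ).trace) =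
    ∑ x, ∑ y, ∑ z, ∑ w, A x y * B z w *
      ∏ i, ∑ b, g i b * (pauli1 d b (y i) (x i) * star (pauli1 d b (z i) (w i))) := by
  have hterm (a : Fin n → ZMod d × ZMod d) : (∏ i, g i (a i)) *
      ((A * pauliN d n a).trace * (B * (pauliN d n a)ᴴ).trace) =
      ∑ x, ∑ y, ∑ z, ∑ w, A x y * B z w *
        ∏ i, g i (a i) * (pauli1 d (a i) (y i) (x i) * star (pauli1 d (a i) (z i) (w i))) := by
    simp only [Matrix.trace, Matrix.diag, Matrix.mul_apply, Matrix.conjTranspose_apply, pauliN,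
      star_prod, Finset.prod_mul_distrib]
    rw [Finset.sum_mul_sum, Finset.mul_sum]
    refine Finset.sum_congr rfl fun x _ => ?_
    simp_rw [Finset.sum_mul_sum, Finset.mul_sum]
    rw [Finset.sum_comm]
    refine Finset.sum_congr rfl fun y _ => Finset.sum_congr rfl fun z _ =>
      Finset.sum_congr rfl fun w _ => ?_
    ring
  simp_rw [hterm]
  rw [Finset.sum_comm]
  refine Finset.sum_congr rfl fun x _ => ?_
  rw [Finset.sum_comm]
  refine Finset.sum_congr rfl fun y _ => ?_
  rw [Finset.sum_comm]
  refine Finset.sum_congr rfl fun z _ => ?_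
  rw [Finset.sum_comm]
  refine Finset.sum_congr rfl fun w _ => ?_
  rw [← Finset.mul_sum, Finset.prod_univ_sum, Fintype.piFinset_univ]

/-- Completeness of the Pauli operators: `Σ_ā Tr(A P_ā) Tr(B P_ā†) = d^n Tr(A B)`. -/
lemma sum_trace_mul_trace [NeZero d] (A B : QOp d n) :
    ∑ a : Fin n → ZMod d × ZMod d, (A * pauliN d n a).trace * (B * (pauliN d n a)ᴴ).trace =
      (d : ℂ) ^ n * (A * B).trace := by
  have h := sum_prod_mul_trace_mul_trace (fun _ _ => 1) A B
  simp only [Finset.prod_const_one, one_mul, sum_pauli1_mul_star] at h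
  rw [h]
  have hprod (x y z w : Fin n → Fin d) :
      (∏ i, if y i = z i ∧ x i = w i then (d : ℂ) else 0) =
        if y = z ∧ x = w then (d : ℂ) ^ n else 0 := by
    rw [Finset.prod_ite_zero]
    simp [funext_iff, forall_and]
  simp only [hprod, Matrix.trace, Matrix.diag, Matrix.mul_apply, Finset.mul_sum]
  refine Finset.sum_congr rfl fun x _ => Finset.sum_congr rfl fun y _ => ?_
  simp [ite_and, mul_comm]

/-- The part of the Pauli pairing of `A` and `B` coming from the `ā` with `a_j = 0`. -/
def pauliPairingAt (d n : ℕ) [NeZero d] (j : Fin n) (A B : QOp d n) : ℂ :=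
  ∑ a : Fin n → ZMod d × ZMod d, (if a j = 0 then 1 else 0) *
    ((A * pauliN d n a).trace * (B * (pauliN d n a)ᴴ).trace)

/-- The kernel of the bilinear form `pauliPairingAt`. -/
def pairingKernel (d n : ℕ) (j : Fin n) (x y z w : Fin n → Fin d) : ℂ :=
  if (x j = y j ∧ z j = w j) ∧ ∀ i, i ≠ j → y i = z i ∧ x i = w i then (d : ℂ) ^ (n - 1) else 0

lemma pauliPairingAt_eq_sum [NeZero d] (j : Fin n) (A B : QOp d n) :
    pauliPairingAt d n j A B =
      ∑ x, ∑ y, ∑ z, ∑ w, A x y * B z w * pairingKernel d n j x y z w := by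
  have h := sum_prod_mul_trace_mul_trace
    (fun i b => if i = j then (if b = 0 then 1 else 0) else 1) A B
  simp only [Finset.prod_ite_eq', Finset.mem_univ, if_true] at h
  rw [pauliPairingAt, h]
  refine Finset.sum_congr rfl fun x _ => Finset.sum_congr rfl fun y _ =>
    Finset.sum_congr rfl fun z _ => Finset.sum_congr rfl fun w _ => ?_
  congr 1
  rw [← Finset.mul_prod_erase _ _ (Finset.mem_univ j)]
  have hj : ∑ b : ZMod d × ZMod d, (if j = j then (if b = 0 then (1 : ℂ) else 0) else 1) *
      (pauli1 d b (y j) (x j) * star (pauli1 d b (z j) (w j))) =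
      if x j = y j ∧ z j = w j then 1 else 0 := by
    by_cases hxy : x j = y j <;> by_cases hzw : z j = w j <;>
      simp [pauli1_zero, eq_comm (a := y j), hxy, hzw]
  have hi : ∀ i ∈ Finset.univ.erase j,
      ∑ b : ZMod d × ZMod d, (if i = j then (if b = 0 then (1 : ℂ) else 0) else 1) *
        (pauli1 d b (y i) (x i) * star (pauli1 d b (z i) (w i))) =
      if y i = z i ∧ x i = w i then (d : ℂ) else 0 := by
    intro i hi
    simp only [Finset.ne_of_mem_erase hi, if_false, one_mul, sum_pauli1_mul_star]
  rw [hj, Finset.prod_congr rfl hi, Finset.prod_ite_zero, pairingKernel]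
  by_cases hxy : x j = y j ∧ z j = w j <;> simp [hxy]

lemma pauliPairingAt_comm [NeZero d] (j : Fin n) (A B : QOp d n) :
    pauliPairingAt d n j A B = pauliPairingAt d n j B A := by
  simp only [pauliPairingAt_eq_sum]
  have hk (x y z w : Fin n → Fin d) :
      pairingKernel d n j x y z w = pairingKernel d n j z w x y := by
    unfold pairingKernel
    congr 1
    simp only [eq_comm, and_comm]
  calc _ = ∑ p : (Fin n → Fin d) × (Fin n → Fin d), ∑ q : (Fin n → Fin d) × (Fin n → Fin d),
        A p.1 p.2 * B q.1 q.2 * pairingKernel d n j p.1 p.2 q.1 q.2 := by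
        simp only [Fintype.sum_prod_type]
    _ = ∑ q : (Fin n → Fin d) × (Fin n → Fin d), ∑ p : (Fin n → Fin d) × (Fin n → Fin d),
        A p.1 p.2 * B q.1 q.2 * pairingKernel d n j p.1 p.2 q.1 q.2 := Finset.sum_comm
    _ = _ := by
        simp only [Fintype.sum_prod_type]
        refine Finset.sum_congr rfl fun x _ => Finset.sum_congr rfl fun y _ =>
          Finset.sum_congr rfl fun z _ => Finset.sum_congr rfl fun w _ => ?_
        rw [hk, mul_comm (A _ _)]

/-- If `H` acts trivially on site `j`, it can be moved from one slot of the pairing to the other. -/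
lemma pauliPairingAt_mul_left [NeZero d] (j : Fin n) (H A B : QOp d n)
    (hH : ∀ u z b c, (if z j = b then H u (Function.update z j c) else 0) =
      if u j = c then H (Function.update u j b) z else 0) :
    pauliPairingAt d n j (A * H) B = pauliPairingAt d n j A (H * B) := by
  have hkernel (x u z w : Fin n → Fin d) :
      ∑ y, H u y * pairingKernel d n j x y z w = ∑ v, H v z * pairingKernel d n j x u v w := by
    rw [Finset.sum_eq_single (Function.update z j (x j)),
      Finset.sum_eq_single (Function.update u j (w j))]
    · by_cases hxw : ∀ i, i ≠ j → x i = w i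
      · have h1 : pairingKernel d n j x (Function.update z j (x j)) z w =
            if z j = w j then (d : ℂ) ^ (n - 1) else 0 :=
          if_congr ⟨fun h => h.1.2, fun h => ⟨⟨by simp, h⟩,
            fun i hi => ⟨Function.update_of_ne hi _ _, hxw i hi⟩⟩⟩ rfl rfl
        have h2 : pairingKernel d n j x u (Function.update u j (w j)) w =
            if u j = x j then (d : ℂ) ^ (n - 1) else 0 :=
          if_congr ⟨fun h => h.1.1.symm, fun h => ⟨⟨h.symm, by simp⟩,
            fun i hi => ⟨(Function.update_of_ne hi _ _).symm, hxw i hi⟩⟩⟩ rfl rfl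
        rw [h1, h2, mul_ite, mul_zero, mul_ite, mul_zero, ← zero_mul ((d : ℂ) ^ (n - 1)),
          ← ite_mul, ← ite_mul, hH u z (w j) (x j)]
      · have h1 (p q : Fin n → Fin d) : ¬ ∀ i, i ≠ j → p i = q i ∧ x i = w i :=
          fun h => hxw fun i hi => (h i hi).2
        simp only [pairingKernel, h1, and_false, if_false, mul_zero]
    · intro v _ hv
      rw [pairingKernel, if_neg, mul_zero]
      rintro ⟨⟨_, h⟩, h'⟩
      apply hv
      rw [Function.eq_update_iff]
      exact ⟨h, fun i hi => (h' i hi).1.symm⟩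
    · simp
    · intro y _ hy
      rw [pairingKernel, if_neg, mul_zero]
      rintro ⟨⟨h, _⟩, h'⟩
      apply hy
      rw [Function.eq_update_iff]
      exact ⟨h.symm, fun i hi => (h' i hi).1⟩
    · simp
  have hleft : pauliPairingAt d n j (A * H) B = ∑ x, ∑ u, ∑ z, ∑ w,
      A x u * B z w * ∑ y, H u y * pairingKernel d n j x y z w := by
    rw [pauliPairingAt_eq_sum]
    refine Finset.sum_congr rfl fun x _ => ?_
    simp only [Matrix.mul_apply, Finset.sum_mul, Finset.mul_sum]
    calc _ = ∑ p : (Fin n → Fin d) × (Fin n → Fin d) × (Fin n → Fin d), ∑ u,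
          A x u * H u p.1 * B p.2.1 p.2.2 * pairingKernel d n j x p.1 p.2.1 p.2.2 := by
          simp only [Fintype.sum_prod_type]
      _ = _ := by
          rw [Finset.sum_comm]
          refine Finset.sum_congr rfl fun u _ => ?_
          rw [Fintype.sum_prod_type, Finset.sum_comm, Fintype.sum_prod_type]
          refine Finset.sum_congr rfl fun z _ => Finset.sum_congr rfl fun w _ =>
            Finset.sum_congr rfl fun y _ => ?_
          ring
  have hright : pauliPairingAt d n j A (H * B) = ∑ x, ∑ u, ∑ z, ∑ w,
      A x u * B z w * ∑ v, H v z * pairingKernel d n j x u v w := by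
    rw [pauliPairingAt_eq_sum]
    refine Finset.sum_congr rfl fun x _ => Finset.sum_congr rfl fun u _ => ?_
    simp only [Matrix.mul_apply, Finset.sum_mul, Finset.mul_sum]
    calc _ = ∑ p : (Fin n → Fin d) × (Fin n → Fin d), ∑ z,
          A x u * (H p.1 z * B z p.2) * pairingKernel d n j x u p.1 p.2 := by
          simp only [Fintype.sum_prod_type]
      _ = _ := by
          rw [Finset.sum_comm]
          refine Finset.sum_congr rfl fun z _ => ?_
          rw [Fintype.sum_prod_type, Finset.sum_comm]
          refine Finset.sum_congr rfl fun w _ => Finset.sum_congr rfl fun v _ => ?_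
          ring
  rw [hleft, hright]
  simp only [hkernel]

lemma pauliPairingAt_sub_left [NeZero d] (j : Fin n) (A A' B : QOp d n) :
    pauliPairingAt d n j (A - A') B = pauliPairingAt d n j A B - pauliPairingAt d n j A' B := by
  simp only [pauliPairingAt, sub_mul, Matrix.trace_sub, mul_sub, Finset.sum_sub_distrib]

lemma pauliPairingAt_commutator_eq_zero [NeZero d] (j : Fin n) (H O : QOp d n)
    (hH : ∀ u z b c, (if z j = b then H u (Function.update z j c) else 0) =
      if u j = c then H (Function.update u j b) z else 0) :
    pauliPairingAt d n j (O * H - H * O) O = 0 := by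
  rw [pauliPairingAt_sub_left, pauliPairingAt_mul_left j H O O hH, pauliPairingAt_comm,
    sub_self]

/-- `H₀ ⊗ I` acts trivially on every site `j` outside the first `k`. -/
lemma extendOp_update {k : ℕ} (hkn : k ≤ n) (H0 : QOp d k) (j : Fin n) (hj : k ≤ (j : ℕ))
    (u z : Fin n → Fin d) (b c : Fin d) :
    (if z j = b then extendOp d k n hkn H0 u (Function.update z j c) else 0) =
      if u j = c then extendOp d k n hkn H0 (Function.update u j b) z else 0 := by
  have hne (i : Fin k) : Fin.castLE hkn i ≠ j := fun h => by
    have := congrArg Fin.val h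
    simp at this
    omega
  have hleft : (z j = b ∧ ∀ i : Fin n, k ≤ (i : ℕ) → u i = Function.update z j c i) ↔
      (u j = c ∧ ∀ i : Fin n, k ≤ (i : ℕ) → Function.update u j b i = z i) := by
    constructor <;> rintro ⟨h, h'⟩ <;>
      refine ⟨by first | simpa using h' j hj | simpa using (h' j hj).symm, fun i hi => ?_⟩ <;>
      have := h' i hi <;> by_cases hij : i = j
    all_goals first | (subst hij; simpa using h.symm) | (subst hij; simpa using h) | skip
    all_goals simpa [hij] using this
  simp only [extendOp, ← ite_and, hleft, ne_eq, hne, not_false_eq_true, Function.update_of_ne]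

/-- The squared (unnormalized) Frobenius norm. -/
def frobSq (d n : ℕ) (A : QOp d n) : ℝ := ∑ x, ∑ y, ‖A x y‖ ^ 2

lemma frobSq_nonneg (A : QOp d n) : 0 ≤ frobSq d n A := by
  unfold frobSq; positivity

lemma trace_conjTranspose_mul_self (A : QOp d n) : (Aᴴ * A).trace = (frobSq d n A : ℂ) := by
  simp only [Matrix.trace, Matrix.diag, Matrix.mul_apply, Matrix.conjTranspose_apply, frobSq]
  rw [Finset.sum_comm]
  push_cast
  refine Finset.sum_congr rfl fun x _ => Finset.sum_congr rfl fun y _ => ?_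
  exact Complex.conj_mul' _

lemma frobSq_eq_of_l2norm_eq_one [NeZero d] {O : QOp d n} (hO : l2norm d n O = 1) :
    frobSq d n O = (d : ℝ) ^ n := by
  have hd : (0 : ℝ) < (d : ℝ) ^ n := pow_pos (Nat.cast_pos.2 (NeZero.pos d)) n
  rw [l2norm, Real.sqrt_eq_one, trace_conjTranspose_mul_self, Complex.ofReal_re,
    div_eq_one_iff_eq hd.ne'] at hO
  exact hO

lemma frobSq_conjTranspose (A : QOp d n) : frobSq d n Aᴴ = frobSq d n A := by
  unfold frobSq
  rw [Finset.sum_comm]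
  simp [Matrix.conjTranspose_apply]

lemma frobSq_mul_le (A B : QOp d n) :
    frobSq d n (A * B) ≤ opNorm d n A ^ 2 * frobSq d n B := by
  unfold frobSq
  rw [Finset.sum_comm, Finset.sum_comm (f := fun x y => ‖B x y‖ ^ 2), Finset.mul_sum]
  refine Finset.sum_le_sum fun y _ => ?_
  have h := (Matrix.toEuclideanCLM (𝕜 := ℂ) (n := Fin n → Fin d) A).le_opNorm
    (WithLp.toLp 2 fun x => B x y)
  rw [Matrix.toEuclideanCLM_toLp] at h
  have h2 := pow_le_pow_left₀ (norm_nonneg _) h 2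
  rw [mul_pow, EuclideanSpace.norm_sq_eq, EuclideanSpace.norm_sq_eq] at h2
  exact h2

lemma opNorm_conjTranspose (A : QOp d n) : opNorm d n Aᴴ = opNorm d n A := by
  rw [opNorm, opNorm, ← Matrix.star_eq_conjTranspose, map_star, ContinuousLinearMap.star_eq_adjoint,
    LinearIsometryEquiv.norm_map]

lemma opNorm_nonneg (A : QOp d n) : 0 ≤ opNorm d n A := norm_nonneg _

lemma frobSq_mul_le' (A B : QOp d n) :
    frobSq d n (A * B) ≤ opNorm d n B ^ 2 * frobSq d n A := by
  rw [← frobSq_conjTranspose (A * B), Matrix.conjTranspose_mul, ← opNorm_conjTranspose B,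
    ← frobSq_conjTranspose A]
  exact frobSq_mul_le _ _

lemma frobSq_commutator_le (H O : QOp d n) :
    frobSq d n (O * H - H * O) ≤ (2 * opNorm d n H) ^ 2 * frobSq d n O := by
  have h : frobSq d n (O * H - H * O) ≤ 2 * (frobSq d n (O * H) + frobSq d n (H * O)) := by
    simp only [frobSq, ← Finset.sum_add_distrib, Finset.mul_sum]
    refine Finset.sum_le_sum fun x _ => Finset.sum_le_sum fun y _ => ?_
    exact (pow_le_pow_left₀ (norm_nonneg _) (norm_sub_le _ _) 2).trans (add_sq_le)
  linarith [frobSq_mul_le H O, frobSq_mul_le' O H]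

lemma sum_norm_trace_mul_sq [NeZero d] (A : QOp d n) :
    ∑ a : Fin n → ZMod d × ZMod d, ‖(A * pauliN d n a).trace‖ ^ 2 =
      (d : ℝ) ^ n * frobSq d n A := by
  have h := sum_trace_mul_trace A Aᴴ
  rw [Matrix.trace_mul_comm, trace_conjTranspose_mul_self] at h
  have hterm (a : Fin n → ZMod d × ZMod d) :
      (A * pauliN d n a).trace * (Aᴴ * (pauliN d n a)ᴴ).trace =
        ((‖(A * pauliN d n a).trace‖ ^ 2 : ℝ) : ℂ) := by
    rw [Matrix.trace_mul_comm Aᴴ, ← Matrix.conjTranspose_mul, Matrix.trace_conjTranspose]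
    push_cast
    exact Complex.mul_conj' _
  simp only [hterm] at h
  exact_mod_cast h

lemma sum_norm_trace_mul_conjTranspose_sq [NeZero d] (A : QOp d n) :
    ∑ a : Fin n → ZMod d × ZMod d, ‖(A * (pauliN d n a)ᴴ).trace‖ ^ 2 =
      (d : ℝ) ^ n * frobSq d n A := by
  rw [← frobSq_conjTranspose, ← sum_norm_trace_mul_sq]
  refine Finset.sum_congr rfl fun a _ => ?_
  rw [Matrix.trace_mul_comm Aᴴ, ← norm_star, ← Matrix.trace_conjTranspose,
    Matrix.conjTranspose_mul, Matrix.conjTranspose_conjTranspose]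

lemma norm_pauliPairingAt_le [NeZero d] (j : Fin n) (A B : QOp d n) :
    ‖pauliPairingAt d n j A B‖ ≤ (d : ℝ) ^ n * (√(frobSq d n A) * √(frobSq d n B)) := by
  calc ‖pauliPairingAt d n j A B‖
      ≤ ∑ a : Fin n → ZMod d × ZMod d,
          ‖(A * pauliN d n a).trace‖ * ‖(B * (pauliN d n a)ᴴ).trace‖ := by
        refine (norm_sum_le _ _).trans (Finset.sum_le_sum fun a _ => ?_)
        rw [norm_mul, norm_mul]
        refine mul_le_of_le_one_left (by positivity) ?_
        split_ifs <;> simp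
    _ ≤ √(∑ a : Fin n → ZMod d × ZMod d, ‖(A * pauliN d n a).trace‖ ^ 2) *
          √(∑ a : Fin n → ZMod d × ZMod d, ‖(B * (pauliN d n a)ᴴ).trace‖ ^ 2) :=
        Real.sum_mul_le_sqrt_mul_sqrt _ _ _
    _ = _ := by
        rw [sum_norm_trace_mul_sq, sum_norm_trace_mul_conjTranspose_sq,
          Real.sqrt_mul (by positivity), Real.sqrt_mul (by positivity), mul_mul_mul_comm,
          Real.mul_self_sqrt (by positivity)]

lemma norm_pauliPairingAt_commutator_le [NeZero d] (j : Fin n) (H O : QOp d n)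
    (hO : l2norm d n O = 1) :
    ‖pauliPairingAt d n j (O * H - H * O) O‖ ≤ (d : ℝ) ^ (2 * n) * (2 * opNorm d n H) := by
  have hop := opNorm_nonneg H
  have hC := Real.sqrt_le_sqrt (frobSq_commutator_le H O)
  rw [Real.sqrt_mul (by positivity), Real.sqrt_sq (by positivity)] at hC
  calc _ ≤ (d : ℝ) ^ n * (√(frobSq d n (O * H - H * O)) * √(frobSq d n O)) :=
        norm_pauliPairingAt_le j _ _
    _ ≤ (d : ℝ) ^ n * (2 * opNorm d n H * √(frobSq d n O) * √(frobSq d n O)) := by gcongr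
    _ = _ := by
        rw [mul_assoc _ (√_), Real.mul_self_sqrt (frobSq_nonneg O),
          frobSq_eq_of_l2norm_eq_one hO]
        ring

/-- The influence rate is minus the normalized sum over sites of the pairings of `[O, H]` with `O`. -/
lemma influenceRate_eq [NeZero d] (H O : QOp d n) :
    influenceRate d n H O =
      -(2 * Complex.I / (d : ℂ) ^ (2 * n)) *
        ∑ j, pauliPairingAt d n j (O * H - H * O) O := by
  set C := O * H - H * O with hC
  have htrace : (C * O).trace = 0 := by
    rw [hC, sub_mul, Matrix.trace_sub, Matrix.mul_assoc H, Matrix.trace_mul_comm H,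
      Matrix.mul_assoc, Matrix.mul_assoc, Matrix.trace_mul_comm, sub_eq_zero, Matrix.mul_assoc,
      Matrix.trace_mul_comm, Matrix.mul_assoc]
  have hzero : ∑ a : Fin n → ZMod d × ZMod d,
      ((C * pauliN d n a).trace * (O * (pauliN d n a)ᴴ).trace +
        (C * (pauliN d n a)ᴴ).trace * (O * pauliN d n a).trace) = 0 := by
    rw [Finset.sum_add_distrib, sum_trace_mul_trace, htrace]
    simp_rw [mul_comm (C * (pauliN d n _)ᴴ).trace]
    rw [sum_trace_mul_trace, Matrix.trace_mul_comm, htrace]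
    simp
  have hweight (a : Fin n → ZMod d × ZMod d) :
      (weight d n a : ℂ) = n - ∑ j, if a j = 0 then 1 else 0 := by
    have := Finset.card_filter_add_card_filter_not (s := Finset.univ) (fun i => a i = 0)
    rw [Finset.card_univ, Fintype.card_fin] at this
    rw [← Finset.sum_filter, Finset.sum_const, nsmul_one, eq_sub_iff_add_eq', weight, ← Nat.cast_add]
    exact congrArg _ this
  have hpair (j : Fin n) : 2 * pauliPairingAt d n j C O =
      ∑ a : Fin n → ZMod d × ZMod d, (if a j = 0 then 1 else 0) *
        ((C * pauliN d n a).trace * (O * (pauliN d n a)ᴴ).trace +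
          (C * (pauliN d n a)ᴴ).trace * (O * pauliN d n a).trace) := by
    rw [two_mul]
    nth_rewrite 2 [pauliPairingAt_comm]
    rw [pauliPairingAt, pauliPairingAt, ← Finset.sum_add_distrib]
    refine Finset.sum_congr rfl fun a _ => ?_
    ring
  rw [influenceRate, ← hC]
  simp_rw [hweight, sub_mul, Finset.sum_sub_distrib, ← Finset.mul_sum]
  simp_rw [hzero, Finset.sum_mul]
  rw [Finset.sum_comm]
  simp_rw [← hpair, ← Finset.mul_sum]
  ring

/-- **Small incremental influence**: if `H = H₀ ⊗ I` acts nontrivially only on the first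
`k` qudits, then `|R_I(H,O)| ≤ 4 k ‖H‖∞` for every `O` with `‖O‖₂ = 1`. -/
theorem influenceRate_le_of_local (n d k : ℕ) (hd : 2 ≤ d) [NeZero d] (hk : 1 ≤ k)
    (hkn : k ≤ n) (H0 : QOp d k) (hH0 : H0.IsHermitian)
    (O : QOp d n) (hO : l2norm d n O = 1) :
    ‖influenceRate d n (extendOp d k n hkn H0) O‖
      ≤ 4 * k * opNorm d n (extendOp d k n hkn H0) := by
  set H := extendOp d k n hkn H0
  have hfar (j : Fin n) (hj : ¬ (j : ℕ) < k) :
      pauliPairingAt d n j (O * H - H * O) O = 0 :=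
    pauliPairingAt_commutator_eq_zero j H O (extendOp_update hkn H0 j (not_lt.1 hj))
  have hcard : (Finset.univ.filter fun j : Fin n => (j : ℕ) < k).card = k := by
    rw [Fin.card_filter_val_lt, min_eq_right hkn]
  have hsum : ‖∑ j, pauliPairingAt d n j (O * H - H * O) O‖ ≤
      k * ((d : ℝ) ^ (2 * n) * (2 * opNorm d n H)) := by
    rw [← Finset.sum_filter_of_ne (p := fun j : Fin n => (j : ℕ) < k)
      fun j _ h => by_contra fun hj => h (hfar j hj)]
    refine (norm_sum_le_of_le _ fun j _ =>
      norm_pauliPairingAt_commutator_le j H O hO).trans_eq ?_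
    rw [Finset.sum_const, hcard, nsmul_eq_mul]
  have hd0 : (0 : ℝ) < (d : ℝ) ^ (2 * n) := pow_pos (Nat.cast_pos.2 (NeZero.pos d)) _
  rw [influenceRate_eq, norm_mul]
  have hconst : ‖-(2 * Complex.I / (d : ℂ) ^ (2 * n))‖ = 2 / (d : ℝ) ^ (2 * n) := by
    simp
  rw [hconst]
  calc _ ≤ 2 / (d : ℝ) ^ (2 * n) * (k * ((d : ℝ) ^ (2 * n) * (2 * opNorm d n H))) := by gcongr
    _ = _ := by
        field_simp
        ring

end QC
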